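/- Let A_{-1}, A_0, A_1, G be as in the context, with G𝟙 = 𝟙, and let σ < 1 be a real number such that (A_{-1} − A_1)𝟙 ≥ (1 − σ)𝟙 entrywise. Then I − A_0 is invertible in B(ℓ∞), and if X : ℕ → B(ℓ∞) satisfies X_0 positive with X_0𝟙 = 𝟙 and X_{k+1} = (I − A_0)^{-1}(A_{-1} + A_1X_k²) for all k, then every X_k is positive with X_k𝟙 = 𝟙, the error E_k := G − X_k satisfies E_k𝟙 = 0, and for every w ∈ ℓ∞ and λ ∈ ℝ with Gw = λw one has ‖E_{k+1} w‖ ≤ ‖(|λ|+1)(I − A_0)^{-1}A_1‖ · ‖E_k w‖ for all k. -/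

import Mathlib

open BoundedContinuousFunction Filter

noncomputable section

/-- ℓ∞: the Banach space of bounded real sequences with the sup norm. -/
abbrev Linf : Type := BoundedContinuousFunction ℕ ℝ

/-- A sequence is nonnegative if all its entries are nonnegative. -/
def vnonneg (x : Linf) : Prop := ∀ i, 0 ≤ x i

/-- An operator in B(ℓ∞) is positive if it maps nonnegative sequences to
nonnegative sequences. -/
def OpPos (A : Linf →L[ℝ] Linf) : Prop := ∀ x : Linf, vnonneg x → vnonneg (A x)

/-- The constant sequence with all entries equal to one. -/
def ones : Linf := BoundedContinuousFunction.const ℕ (1 : ℝ)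

theorem sub_fixedPoint_step {R : Type*} [Ring R] {a b c d g : R} (hd : d * (1 - b) = 1)
    (h : c * g ^ 2 + b * g + a = g) (x : R) :
    g - d * (a + c * x ^ 2) = d * c * (x * (g - x) + (g - x) * g) := by
  have h1 : a + c * g ^ 2 = (1 - b) * g := by
    rw [sub_mul, one_mul, eq_sub_iff_add_eq]
    calc a + c * g ^ 2 + b * g = c * g ^ 2 + b * g + a := by abel
      _ = g := h
  have h2 : g = d * (a + c * g ^ 2) := by
    rw [h1, ← mul_assoc, hd, one_mul]
  calc g - d * (a + c * x ^ 2)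
      = d * (a + c * g ^ 2) - d * (a + c * x ^ 2) := by rw [← h2]
    _ = d * c * (x * (g - x) + (g - x) * g) := by noncomm_ring

theorem opNorm_smul_of_nonneg {E : Type*} [NormedAddCommGroup E] [NormedSpace ℝ E] {c : ℝ}
    (hc : 0 ≤ c) (f : E →L[ℝ] E) : ‖c • f‖ = c * ‖f‖ := by
  rw [norm_smul, Real.norm_of_nonneg hc]

theorem OpPos.mono {A : Linf →L[ℝ] Linf} (hA : OpPos A) {x y : Linf} (h : ∀ i, x i ≤ y i)
    (i : ℕ) : A x i ≤ A y i := by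
  have := hA (y - x) (fun j => by simpa using h j) i
  simpa [map_sub] using this

theorem OpPos.add {A C : Linf →L[ℝ] Linf} (hA : OpPos A) (hC : OpPos C) : OpPos (A + C) :=
  fun x hx i => by simpa using add_nonneg (hA x hx i) (hC x hx i)

theorem OpPos.mul {A C : Linf →L[ℝ] Linf} (hA : OpPos A) (hC : OpPos C) : OpPos (A * C) :=
  fun x hx => hA _ (hC x hx)

@[simp] theorem ones_apply (i : ℕ) : ones i = 1 := rfl

theorem vnonneg_ones : vnonneg ones := fun i => by simp

theorem OpPos.smul_le {A : Linf →L[ℝ] Linf} (hA : OpPos A) {c : ℝ} {x : Linf}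
    (h : ∀ i, c ≤ x i) (i : ℕ) : c * A ones i ≤ A x i := by
  simpa using hA.mono (x := c • ones) (y := x) (fun j => by simpa using h j) i

/-- A positive operator has norm at most any upper bound of its value at the constant one. -/
theorem OpPos.opNorm_le {A : Linf →L[ℝ] Linf} (hA : OpPos A) {c : ℝ}
    (h : ∀ i, A ones i ≤ c) : ‖A‖ ≤ c := by
  have hc : 0 ≤ c := (hA _ vnonneg_ones 0).trans (h 0)
  refine A.opNorm_le_bound hc fun x => ?_
  refine (BoundedContinuousFunction.norm_le (by positivity)).2 fun i => ?_
  have hx (j : ℕ) := abs_le.1 (x.norm_coe_le_norm j)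
  have h1 := hA.smul_le (c := -‖x‖) (x := x) (fun j => (hx j).1) i
  have h2 := hA.smul_le (c := -‖x‖) (x := -x)
    (fun j => by simpa using (hx j).2) i
  have h3 := mul_le_mul_of_nonneg_left (h i) (norm_nonneg x)
  simp only [map_neg, BoundedContinuousFunction.coe_neg, Pi.neg_apply] at h2
  rw [Real.norm_eq_abs, abs_le]
  constructor <;> linarith

/-- A right inverse of `1 - A` is positive if `A` is positive with `A 1 ≤ c` for some `c < 1`. -/
theorem OpPos.of_one_sub_mul_eq_one {A B : Linf →L[ℝ] Linf} (hA : OpPos A) {c : ℝ} (hc : c < 1)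
    (h : ∀ i, A ones i ≤ c) (hB : (1 - A) * B = 1) : OpPos B := by
  intro x hx i
  have hc0 : 0 ≤ c := (hA _ vnonneg_ones 0).trans (h 0)
  have hfix (j : ℕ) : B x j = x j + A (B x) j := by
    have := congrArg (fun T : Linf →L[ℝ] Linf => T x j) hB
    simp only [mul_apply_eq_comp, _root_.sub_apply,
      one_apply_eq_self, BoundedContinuousFunction.coe_sub, Pi.sub_apply] at this
    linarith
  have key (n : ℕ) : ∀ j, -(‖B x‖ * c ^ n) ≤ B x j := by
    induction n with
    | zero => simpa using fun j => (abs_le.1 ((B x).norm_coe_le_norm j)).1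
    | succ n ih =>
      intro j
      have h1 := hA.smul_le ih j
      have h2 := mul_le_mul_of_nonneg_left (h j)
        (mul_nonneg (norm_nonneg (B x)) (pow_nonneg hc0 n))
      have h3 := hx j
      rw [hfix j, pow_succ]
      linarith
  have hlim : Tendsto (fun n : ℕ => -(‖B x‖ * c ^ n)) atTop (nhds 0) := by
    simpa using ((tendsto_pow_atTop_nhds_zero_of_lt_one hc0 hc).const_mul ‖B x‖).neg
  exact le_of_tendsto' hlim fun n => key n i

/-- Iteration F₂ with a row-stochastic starting matrix: I - A₀ is invertible,
the iterates remain row-stochastic, the error kills 𝟙, and the error along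
eigenvectors of G contracts with factor ‖(|λ|+1)(I-A₀)⁻¹A₁‖. -/
theorem stmt5
    (Am1 A0 A1 G : Linf →L[ℝ] Linf)
    (hAm1 : OpPos Am1) (hA0 : OpPos A0) (hA1 : OpPos A1) (hG : OpPos G)
    (hstoch : (Am1 + A0 + A1) ones = ones)
    (heq : A1 * G ^ 2 + A0 * G + Am1 = G)
    (hG1 : G ones = ones)
    (σ : ℝ) (hσ : σ < 1)
    (hgap : ∀ i, 1 - σ ≤ ((Am1 - A1) ones) i) :
    ∃ B : Linf →L[ℝ] Linf, (1 - A0) * B = 1 ∧ B * (1 - A0) = 1 ∧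
      ∀ X : ℕ → Linf →L[ℝ] Linf,
        OpPos (X 0) → (X 0) ones = ones →
        (∀ k, X (k + 1) = B * (Am1 + A1 * (X k) ^ 2)) →
        (∀ k, OpPos (X k) ∧ (X k) ones = ones) ∧
        (∀ k, (G - X k) ones = 0) ∧
        ∀ (w : Linf) (lam : ℝ), G w = lam • w →
          ∀ k, ‖(G - X (k + 1)) w‖ ≤ ‖(|lam| + 1) • (B * A1)‖ * ‖(G - X k) w‖ := by
  have hA0c (i : ℕ) : A0 ones i ≤ σ := by
    have h1 := congrArg (fun y : Linf => y i) hstoch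
    have h2 := hgap i
    have h3 := hA1 _ vnonneg_ones i
    simp at h1 h2
    linarith
  obtain ⟨u, hu⟩ := isUnit_one_sub_of_norm_lt_one (R := Linf →L[ℝ] Linf)
    ((hA0.opNorm_le hA0c).trans_lt hσ)
  obtain ⟨B, hB1, hB2⟩ : ∃ B : Linf →L[ℝ] Linf, (1 - A0) * B = 1 ∧ B * (1 - A0) = 1 :=
    ⟨↑u⁻¹, by rw [← hu, Units.mul_inv], by rw [← hu, Units.inv_mul]⟩
  have hB : OpPos B := hA0.of_one_sub_mul_eq_one hσ hA0c hB1
  refine ⟨B, hB1, hB2, fun X hX0 hX01 hX => ?_⟩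
  have hsto (k : ℕ) : OpPos (X k) ∧ (X k) ones = ones := by
    induction k with
    | zero => exact ⟨hX0, hX01⟩
    | succ k ih =>
      obtain ⟨hp, h1⟩ := ih
      rw [hX, pow_two]
      refine ⟨hB.mul (hAm1.add (hA1.mul (hp.mul hp))), ?_⟩
      have h2 : Am1 ones + A1 ones = (1 - A0) ones := by
        simp only [_root_.add_apply] at hstoch
        rw [_root_.sub_apply, one_apply_eq_self, eq_sub_iff_add_eq]
        nth_rewrite 4 [← hstoch]
        abel
      simp only [mul_apply_eq_comp, _root_.add_apply, h1, h2]
      exact congrArg (fun T : Linf →L[ℝ] Linf => T ones) hB2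
  refine ⟨hsto, fun k => by simp [hG1, (hsto k).2], fun w lam hw k => ?_⟩
  have hE : G - X (k + 1) = (B * A1) * (X k * (G - X k) + (G - X k) * G) := by
    rw [hX]
    exact sub_fixedPoint_step (R := Linf →L[ℝ] Linf) hB2 heq (X k)
  have hXn : ‖X k‖ ≤ 1 := (hsto k).1.opNorm_le fun i => by simp [(hsto k).2]
  have hEw : (G - X (k + 1)) w = (B * A1) (X k ((G - X k) w) + lam • (G - X k) w) := by
    rw [hE, ← map_smul, ← hw]
    rfl
  have hbound : ‖X k ((G - X k) w) + lam • (G - X k) w‖ ≤ (|lam| + 1) * ‖(G - X k) w‖ := by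
    have h1 := (X k).le_of_opNorm_le hXn ((G - X k) w)
    have h2 := norm_add_le (X k ((G - X k) w)) (lam • (G - X k) w)
    rw [norm_smul, Real.norm_eq_abs] at h2
    linarith
  have hpos : 0 ≤ |lam| + 1 := by positivity
  calc ‖(G - X (k + 1)) w‖
      ≤ ‖B * A1‖ * ‖X k ((G - X k) w) + lam • (G - X k) w‖ := by
        rw [hEw]
        exact (B * A1).le_opNorm _
    _ ≤ ‖B * A1‖ * ((|lam| + 1) * ‖(G - X k) w‖) := by gcongr
    _ = ‖(|lam| + 1) • (B * A1)‖ * ‖(G - X k) w‖ := by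
        rw [opNorm_smul_of_nonneg hpos]
        ring
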